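/- arXiv:1905.05983 — 3 statements merged into one kernel-verified Lean document; each statement's English description precedes it below -/
import Mathlib

section
/- For every integer n ≥ 3, the topological boundary of 𝒜_{3,n} is equal to the union of ℬ⁺_n and ℬ⁻_n. -/
/-- The Minkowski sum of `n` copies of the twisted cubic segment
`{(t, t^2, t^3) : -1 <= t <= 1}`. -/
def A3 (n : ℕ) : Set (ℝ × ℝ × ℝ) :=
  {p | ∃ t : Fin n → ℝ, (∀ i, -1 ≤ t i ∧ t i ≤ 1) ∧
       p = (∑ i, t i, ∑ i, (t i) ^ 2, ∑ i, (t i) ^ 3)}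

/-- The set `C⁺_{k,a}`. -/
def Cplus (k a : ℕ) : Set (ℝ × ℝ × ℝ) :=
  {p | ∃ s t : ℝ, -1 ≤ s ∧ s ≤ t ∧ t ≤ 1 ∧
       p = ((k : ℝ) * s + t + a, (k : ℝ) * s ^ 2 + t ^ 2 + a, (k : ℝ) * s ^ 3 + t ^ 3 + a)}

/-- The set `C⁻_{ℓ,b}`. -/
def Cminus (l b : ℕ) : Set (ℝ × ℝ × ℝ) :=
  {p | ∃ s t : ℝ, -1 ≤ s ∧ s ≤ t ∧ t ≤ 1 ∧
       p = (s + (l : ℝ) * t - b, s ^ 2 + (l : ℝ) * t ^ 2 + b, s ^ 3 + (l : ℝ) * t ^ 3 - b)}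

/-- The set `ℬ⁺_n`. -/
def Bplus (n : ℕ) : Set (ℝ × ℝ × ℝ) := ⋃ k ∈ Finset.Icc 1 (n - 1), Cplus k (n - k - 1)

/-- The set `ℬ⁻_n`. -/
def Bminus (n : ℕ) : Set (ℝ × ℝ × ℝ) := ⋃ l ∈ Finset.Icc 1 (n - 1), Cminus l (n - l - 1)

open Topology

/-- The sum of the points `(t, t², t³)` over a multiset of parameters `t`. -/
def curveSum (M : Multiset ℝ) : ℝ × ℝ × ℝ := (M.map fun t : ℝ => (t, t ^ 2, t ^ 3)).sum

@[simp] lemma curveSum_cons (x : ℝ) (M : Multiset ℝ) :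
    curveSum (x ::ₘ M) = (x, x ^ 2, x ^ 3) + curveSum M := by
  simp [curveSum]

@[simp] lemma curveSum_add (M N : Multiset ℝ) :
    curveSum (M + N) = curveSum M + curveSum N := by
  simp [curveSum]

@[simp] lemma curveSum_replicate (k : ℕ) (x : ℝ) :
    curveSum (Multiset.replicate k x) = (k * x, k * x ^ 2, k * x ^ 3) := by
  simp [curveSum]

lemma curveSum_univ_map {n : ℕ} (t : Fin n → ℝ) :
    curveSum (Finset.univ.val.map t) = (∑ i, t i, ∑ i, t i ^ 2, ∑ i, t i ^ 3) := by
  have h : curveSum (Finset.univ.val.map t) = ∑ i, ((t i, t i ^ 2, t i ^ 3) : ℝ × ℝ × ℝ) := by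
    simp only [curveSum, Finset.sum, Multiset.map_map, Function.comp_def]
  rw [h]
  ext <;> simp [Prod.fst_sum, Prod.snd_sum]

lemma mem_A3_iff {n : ℕ} {p : ℝ × ℝ × ℝ} :
    p ∈ A3 n ↔ ∃ M : Multiset ℝ, M.card = n ∧ (∀ x ∈ M, -1 ≤ x ∧ x ≤ 1) ∧ p = curveSum M := by
  constructor
  · rintro ⟨t, ht, rfl⟩
    refine ⟨Finset.univ.val.map t, by simp, ?_, (curveSum_univ_map t).symm⟩
    intro x hx
    obtain ⟨i, -, rfl⟩ := Multiset.mem_map.1 hx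
    exact ht i
  · rintro ⟨M, hM, hx, rfl⟩
    induction M using Quotient.inductionOn with
    | h l =>
      obtain rfl : l.length = n := by simpa using hM
      refine ⟨l.get, fun i => hx _ (by simp), ?_⟩
      rw [← curveSum_univ_map]
      simp

/-! ### Points with three distinct parameters in the open interval -/

lemma map_nhds_threefold_sum {x y z : ℝ} (hxy : x ≠ y) (hyz : y ≠ z) (hxz : x ≠ z)
    (m : ℝ × ℝ × ℝ) :
    Filter.map (fun v : ℝ × ℝ × ℝ => (v.1 + v.2.1 + v.2.2 + m.1,
        v.1 ^ 2 + v.2.1 ^ 2 + v.2.2 ^ 2 + m.2.1,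
        v.1 ^ 3 + v.2.1 ^ 3 + v.2.2 ^ 3 + m.2.2)) (𝓝 (x, y, z)) =
      𝓝 (x + y + z + m.1, x ^ 2 + y ^ 2 + z ^ 2 + m.2.1, x ^ 3 + y ^ 3 + z ^ 3 + m.2.2) := by
  let π₁ : ℝ × ℝ × ℝ →L[ℝ] ℝ := .fst ℝ ℝ (ℝ × ℝ)
  let π₂ : ℝ × ℝ × ℝ →L[ℝ] ℝ := (ContinuousLinearMap.fst ℝ ℝ ℝ).comp (.snd ℝ ℝ (ℝ × ℝ))
  let π₃ : ℝ × ℝ × ℝ →L[ℝ] ℝ := (ContinuousLinearMap.snd ℝ ℝ ℝ).comp (.snd ℝ ℝ (ℝ × ℝ))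
  have h₁ : HasStrictFDerivAt (fun v : ℝ × ℝ × ℝ => v.1) π₁ (x, y, z) := π₁.hasStrictFDerivAt
  have h₂ : HasStrictFDerivAt (fun v : ℝ × ℝ × ℝ => v.2.1) π₂ (x, y, z) := π₂.hasStrictFDerivAt
  have h₃ : HasStrictFDerivAt (fun v : ℝ × ℝ × ℝ => v.2.2) π₃ (x, y, z) := π₃.hasStrictFDerivAt
  have H := (((h₁.add h₂).add h₃).add_const m.1).prodMk
    (((((h₁.pow 2).add (h₂.pow 2)).add (h₃.pow 2)).add_const m.2.1).prodMk
      ((((h₁.pow 3).add (h₂.pow 3)).add (h₃.pow 3)).add_const m.2.2))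
  refine HasStrictFDerivAt.map_nhds_eq_of_surj H (LinearMap.range_eq_top.2 ?_)
  rintro ⟨u, v, w⟩
  have a1 := sub_ne_zero.2 hxy
  have a2 := sub_ne_zero.2 hyz
  have a3 := sub_ne_zero.2 hxz
  have b1 : y - x ≠ 0 := sub_ne_zero.2 hxy.symm
  have b2 : z - y ≠ 0 := sub_ne_zero.2 hyz.symm
  have b3 : z - x ≠ 0 := sub_ne_zero.2 hxz.symm
  refine ⟨((w / 3 - (y + z) * (v / 2) + y * z * u) / ((y - x) * (z - x)),
    -(w / 3 - (x + z) * (v / 2) + x * z * u) / ((y - x) * (z - y)),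
    (w / 3 - (x + y) * (v / 2) + x * y * u) / ((z - x) * (z - y))), ?_⟩
  ext
  · simp [π₁, π₂, π₃]
    field_simp
    ring
  · simp [π₁, π₂, π₃]
    field_simp
    ring
  · simp [π₁, π₂, π₃]
    field_simp
    ring

lemma curveSum_mem_interior_of_three {n : ℕ} {x y z : ℝ} {M : Multiset ℝ}
    (hx : x ∈ Set.Ioo (-1 : ℝ) 1) (hy : y ∈ Set.Ioo (-1 : ℝ) 1) (hz : z ∈ Set.Ioo (-1 : ℝ) 1)
    (hxy : x ≠ y) (hyz : y ≠ z) (hxz : x ≠ z) (hM : ∀ u ∈ M, -1 ≤ u ∧ u ≤ 1)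
    (hn : (x ::ₘ y ::ₘ z ::ₘ M).card = n) :
    curveSum (x ::ₘ y ::ₘ z ::ₘ M) ∈ interior (A3 n) := by
  have hsum (a b c : ℝ) : curveSum (a ::ₘ b ::ₘ c ::ₘ M) = (a + b + c + (curveSum M).1,
      a ^ 2 + b ^ 2 + c ^ 2 + (curveSum M).2.1, a ^ 3 + b ^ 3 + c ^ 3 + (curveSum M).2.2) := by
    ext <;> simp <;> ring
  rw [mem_interior_iff_mem_nhds, hsum, ← map_nhds_threefold_sum hxy hyz hxz, Filter.mem_map]
  have hU : Set.Ioo (-1 : ℝ) 1 ×ˢ Set.Ioo (-1 : ℝ) 1 ×ˢ Set.Ioo (-1 : ℝ) 1 ∈ 𝓝 (x, y, z) :=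
    (isOpen_Ioo.prod (isOpen_Ioo.prod isOpen_Ioo)).mem_nhds ⟨hx, hy, hz⟩
  filter_upwards [hU]
  rintro ⟨a, b, c⟩ ⟨ha, hb, hc⟩
  refine mem_A3_iff.2 ⟨a ::ₘ b ::ₘ c ::ₘ M, by simpa using hn, ?_, (hsum a b c).symm⟩
  intro u hu
  simp only [Multiset.mem_cons] at hu
  rcases hu with rfl | rfl | rfl | hu
  · exact ⟨ha.1.le, ha.2.le⟩
  · exact ⟨hb.1.le, hb.2.le⟩
  · exact ⟨hc.1.le, hc.2.le⟩
  · exact hM u hu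

/-! ### Deforming four parameters -/

/-- The monic quartic with roots `a, b, c, d`. -/
def quartic (a b c d u : ℝ) : ℝ := (u - a) * (u - b) * (u - c) * (u - d)

lemma continuous_quartic (a b c d : ℝ) : Continuous (quartic a b c d) := by
  unfold quartic
  fun_prop

/-- Four distinct points at which a monic quartic takes a common value have the same first three
power sums as the roots of the quartic. -/
lemma curveSum_eq_of_quartic_eq {a b c d e p q r s : ℝ}
    (hp : quartic a b c d p = e) (hq : quartic a b c d q = e)
    (hr : quartic a b c d r = e) (hs : quartic a b c d s = e)
    (hpq : p < q) (hqr : q < r) (hrs : r < s) (M : Multiset ℝ) :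
    curveSum (p ::ₘ q ::ₘ r ::ₘ s ::ₘ M) = curveSum (a ::ₘ b ::ₘ c ::ₘ d ::ₘ M) := by
  unfold quartic at hp hq hr hs
  set e₁ := a + b + c + d with he₁
  set e₂ := a * b + a * c + a * d + b * c + b * d + c * d with he₂
  set e₃ := a * b * c + a * b * d + a * c * d + b * c * d with he₃
  have key₂ {x y : ℝ} (hxy : x < y) (hx : (x - a) * (x - b) * (x - c) * (x - d) = e)
      (hy : (y - a) * (y - b) * (y - c) * (y - d) = e) :
      (x ^ 3 + x ^ 2 * y + x * y ^ 2 + y ^ 3) - e₁ * (x ^ 2 + x * y + y ^ 2) + e₂ * (x + y) - e₃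
        = 0 := by
    have h : (y - x) ≠ 0 := sub_ne_zero.2 hxy.ne'
    apply mul_left_cancel₀ h
    rw [he₁, he₂, he₃]
    linear_combination hy - hx
  have k₁ := key₂ hpq hp hq
  have k₂ := key₂ (hpq.trans hqr) hp hr
  have k₃ := key₂ (hpq.trans (hqr.trans hrs)) hp hs
  have l₁ : (p ^ 2 + q ^ 2 + r ^ 2 + p * q + p * r + q * r) - e₁ * (p + q + r) + e₂ = 0 := by
    apply mul_left_cancel₀ (sub_ne_zero.2 hqr.ne')
    linear_combination k₂ - k₁
  have l₂ : (p ^ 2 + q ^ 2 + s ^ 2 + p * q + p * s + q * s) - e₁ * (p + q + s) + e₂ = 0 := by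
    apply mul_left_cancel₀ (sub_ne_zero.2 (hqr.trans hrs).ne')
    linear_combination k₃ - k₁
  have m₁ : p + q + r + s - e₁ = 0 := by
    apply mul_left_cancel₀ (sub_ne_zero.2 hrs.ne')
    linear_combination l₂ - l₁
  have n₁ : p + q + r + s = a + b + c + d := by linarith
  have n₂ : p * q + p * r + p * s + q * r + q * s + r * s = e₂ := by
    linear_combination (p + q + r) * m₁ - l₁
  have n₃ : p * q * r + p * q * s + p * r * s + q * r * s = e₃ := by
    linear_combination (p + q) * n₂ + k₁ - (p ^ 2 + p * q + q ^ 2) * m₁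
  have s₂ : p ^ 2 + q ^ 2 + r ^ 2 + s ^ 2 = a ^ 2 + b ^ 2 + c ^ 2 + d ^ 2 := by
    linear_combination (p + q + r + s + a + b + c + d) * n₁ - 2 * n₂
  have s₃ : p ^ 3 + q ^ 3 + r ^ 3 + s ^ 3 = a ^ 3 + b ^ 3 + c ^ 3 + d ^ 3 := by
    have expand (p q r s : ℝ) : p ^ 3 + q ^ 3 + r ^ 3 + s ^ 3 = (p + q + r + s) ^ 3
        - 3 * (p + q + r + s) * (p * q + p * r + p * s + q * r + q * s + r * s)
        + 3 * (p * q * r + p * q * s + p * r * s + q * r * s) := by ring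
    rw [expand p q r s, expand a b c d, n₁, n₂, n₃]
  ext
  · simp only [curveSum_cons, Prod.fst_add]
    linear_combination n₁
  · simp only [curveSum_cons, Prod.fst_add, Prod.snd_add]
    linear_combination s₂
  · simp only [curveSum_cons, Prod.snd_add]
    linear_combination s₃

lemma curveSum_mem_interior_of_alternating {n : ℕ} {a b c d e u₀ u₁ u₂ u₃ u₄ : ℝ}
    {M : Multiset ℝ} (h₀ : -1 ≤ u₀) (h₀₁ : u₀ < u₁) (h₁₂ : u₁ < u₂) (h₂₃ : u₂ < u₃)
    (h₃₄ : u₃ < u₄) (h₄ : u₄ ≤ 1)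
    (hu₀ : e < quartic a b c d u₀) (hu₁ : quartic a b c d u₁ < e)
    (hu₂ : e < quartic a b c d u₂) (hu₃ : quartic a b c d u₃ < e)
    (hu₄ : e < quartic a b c d u₄) (hM : ∀ u ∈ M, -1 ≤ u ∧ u ≤ 1)
    (hn : (a ::ₘ b ::ₘ c ::ₘ d ::ₘ M).card = n) :
    curveSum (a ::ₘ b ::ₘ c ::ₘ d ::ₘ M) ∈ interior (A3 n) := by
  have hc (s : Set ℝ) : ContinuousOn (quartic a b c d) s :=
    (continuous_quartic a b c d).continuousOn
  obtain ⟨p, ⟨hp, hp'⟩, hpe⟩ := intermediate_value_Ioo' h₀₁.le (hc _) ⟨hu₁, hu₀⟩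
  obtain ⟨q, ⟨hq, hq'⟩, hqe⟩ := intermediate_value_Ioo h₁₂.le (hc _) ⟨hu₁, hu₂⟩
  obtain ⟨r, ⟨hr, hr'⟩, hre⟩ := intermediate_value_Ioo' h₂₃.le (hc _) ⟨hu₃, hu₂⟩
  obtain ⟨s, ⟨hs, hs'⟩, hse⟩ := intermediate_value_Ioo h₃₄.le (hc _) ⟨hu₃, hu₄⟩
  rw [← curveSum_eq_of_quartic_eq hpe hqe hre hse (by linarith) (by linarith) (by linarith)]
  refine curveSum_mem_interior_of_three ⟨by linarith, by linarith⟩ ⟨by linarith, by linarith⟩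
    ⟨by linarith, by linarith⟩ (by linarith : p < q).ne (by linarith : q < r).ne
    (by linarith : p < r).ne ?_ (by simpa using hn)
  intro u hu
  rcases Multiset.mem_cons.1 hu with rfl | hu
  · exact ⟨by linarith, by linarith⟩
  · exact hM u hu

lemma curveSum_mem_interior_of_pairs {n : ℕ} {s t : ℝ} {M : Multiset ℝ}
    (hs : -1 < s) (hst : s < t) (ht : t < 1) (hM : ∀ u ∈ M, -1 ≤ u ∧ u ≤ 1)
    (hn : (s ::ₘ s ::ₘ t ::ₘ t ::ₘ M).card = n) :
    curveSum (s ::ₘ s ::ₘ t ::ₘ t ::ₘ M) ∈ interior (A3 n) := by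
  have hpos {u : ℝ} (h : u ≠ s) (h' : u ≠ t) : 0 < quartic s s t t u := by
    have := sub_ne_zero.2 h
    have := sub_ne_zero.2 h'
    have h : quartic s s t t u = ((u - s) * (u - t)) ^ 2 := by unfold quartic; ring
    rw [h]
    positivity
  obtain ⟨u₂, h₂, h₂'⟩ := exists_between hst
  have p₀ := hpos hs.ne (hs.trans hst).ne
  have p₂ := hpos h₂.ne' h₂'.ne
  have p₄ := hpos (hst.trans ht).ne' ht.ne'
  obtain ⟨e, he, he'⟩ := exists_between (lt_min p₀ (lt_min p₂ p₄))
  simp only [lt_min_iff] at he'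
  exact curveSum_mem_interior_of_alternating le_rfl hs h₂ h₂' ht le_rfl he'.1
    (by simpa [quartic] using he) he'.2.1 (by simpa [quartic] using he) he'.2.2 hM hn

lemma curveSum_mem_interior_of_inner {n : ℕ} {a s t d : ℝ} {M : Multiset ℝ}
    (ha : -1 ≤ a) (has : a < s) (hst : s ≤ t) (htd : t < d) (hd : d ≤ 1)
    (hM : ∀ u ∈ M, -1 ≤ u ∧ u ≤ 1) (hn : (a ::ₘ s ::ₘ t ::ₘ d ::ₘ M).card = n) :
    curveSum (a ::ₘ s ::ₘ t ::ₘ d ::ₘ M) ∈ interior (A3 n) := by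
  obtain ⟨u₁, h₁, h₁'⟩ := exists_between has
  obtain ⟨u₃, h₃, h₃'⟩ := exists_between htd
  have p₁ : quartic a s t d u₁ < 0 := by
    have := mul_pos (mul_pos (mul_pos (sub_pos.2 h₁) (sub_pos.2 h₁'))
      (sub_pos.2 (h₁'.trans_le hst))) (sub_pos.2 ((h₁'.trans_le hst).trans htd))
    unfold quartic
    linarith
  have p₃ : quartic a s t d u₃ < 0 := by
    have := mul_pos (mul_pos (mul_pos (sub_pos.2 ((has.trans_le hst).trans h₃))
      (sub_pos.2 (hst.trans_lt h₃))) (sub_pos.2 h₃)) (sub_pos.2 h₃')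
    unfold quartic
    linarith
  have p₂ : 0 ≤ quartic a s t d ((s + t) / 2) := by
    have := mul_nonneg (mul_nonneg (sub_nonneg.2 (has.le.trans (by linarith : s ≤ (s + t) / 2)))
      (sub_nonneg.2 ((by linarith : (s + t) / 2 ≤ t).trans htd.le))) (sq_nonneg (t - s))
    unfold quartic
    linarith
  obtain ⟨e, he, he'⟩ := exists_between (max_lt p₁ p₃)
  obtain ⟨he₁, he₃⟩ := max_lt_iff.1 he
  exact curveSum_mem_interior_of_alternating ha h₁ (by linarith) (by linarith) h₃' hd
    (by simpa [quartic] using he') he₁ (he'.trans_le p₂) he₃ (by simpa [quartic] using he') hM hn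

/-! ### Points outside the interior -/

lemma mem_Bplus {n k a : ℕ} {s t : ℝ} (hs : -1 ≤ s) (hst : s ≤ t) (ht : t ≤ 1)
    (hk : 1 ≤ k) (hn : k + 1 + a = n) :
    ((k : ℝ) * s + t + a, (k : ℝ) * s ^ 2 + t ^ 2 + a, (k : ℝ) * s ^ 3 + t ^ 3 + a) ∈ Bplus n := by
  simp only [Bplus, Set.mem_iUnion, Finset.mem_Icc, exists_prop]
  obtain rfl : a = n - k - 1 := by omega
  exact ⟨k, ⟨hk, by omega⟩, s, t, hs, hst, ht, rfl⟩

lemma mem_Bminus {n l b : ℕ} {s t : ℝ} (hs : -1 ≤ s) (hst : s ≤ t) (ht : t ≤ 1)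
    (hl : 1 ≤ l) (hn : b + 1 + l = n) :
    (s + (l : ℝ) * t - b, s ^ 2 + (l : ℝ) * t ^ 2 + b, s ^ 3 + (l : ℝ) * t ^ 3 - b) ∈
      Bminus n := by
  simp only [Bminus, Set.mem_iUnion, Finset.mem_Icc, exists_prop]
  obtain rfl : b = n - l - 1 := by omega
  exact ⟨l, ⟨hl, by omega⟩, s, t, hs, hst, ht, rfl⟩

lemma mem_Bplus_of_eq {n k a : ℕ} {s : ℝ} (hs : -1 ≤ s) (hs' : s ≤ 1) (hn : k + a = n)
    (h2 : 2 ≤ n) :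
    ((k : ℝ) * s + a, (k : ℝ) * s ^ 2 + a, (k : ℝ) * s ^ 3 + a) ∈ Bplus n := by
  rcases k with _ | k
  · convert mem_Bplus (n := n) (k := 1) (a := n - 2) (s := 1) (t := 1) (by norm_num) le_rfl le_rfl
      le_rfl (by omega) using 1
    obtain ⟨m, rfl⟩ := Nat.exists_eq_add_of_le' h2
    obtain rfl : a = m + 2 := by omega
    ext <;> simp <;> ring
  · rcases a with _ | a
    · convert mem_Bplus (n := n) (k := k) (a := 0) hs le_rfl hs' (by omega) (by omega) using 1
      ext <;> simp <;> ring
    · convert mem_Bplus (n := n) (k := k + 1) (a := a) hs hs' le_rfl (by omega) (by omega) using 1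
      ext <;> simp <;> ring

lemma mem_Bminus_of_eq {n b l : ℕ} {t : ℝ} (ht : -1 ≤ t) (ht' : t ≤ 1) (hb : 1 ≤ b) (hl : 1 ≤ l)
    (hn : b + l = n) :
    ((l : ℝ) * t - b, (l : ℝ) * t ^ 2 + b, (l : ℝ) * t ^ 3 - b) ∈ Bminus n := by
  obtain ⟨b, rfl⟩ := Nat.exists_eq_add_of_le' hb
  convert mem_Bminus (n := n) (l := l) (b := b) le_rfl ht ht' hl (by omega) using 1
  ext <;> simp <;> ring

/-- The multiset in which `-1`, `s`, `t`, `1` occur with multiplicities `b`, `k`, `l`, `a`. -/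
def fourValues (b k l a : ℕ) (s t : ℝ) : Multiset ℝ :=
  .replicate b (-1) + .replicate k s + .replicate l t + .replicate a 1

lemma curveSum_fourValues (b k l a : ℕ) (s t : ℝ) :
    curveSum (fourValues b k l a s t) = (k * s + l * t + a - b,
      k * s ^ 2 + l * t ^ 2 + a + b, k * s ^ 3 + l * t ^ 3 + a - b) := by
  ext <;> simp [fourValues] <;> ring

lemma card_fourValues (b k l a : ℕ) (s t : ℝ) :
    (fourValues b k l a s t).card = b + k + l + a := by
  simp [fourValues]

lemma mem_Icc_of_mem_fourValues {b k l a : ℕ} {s t u : ℝ} (hs : -1 < s) (hst : s < t) (ht : t < 1)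
    (hu : u ∈ fourValues b k l a s t) : -1 ≤ u ∧ u ≤ 1 := by
  simp only [fourValues, Multiset.mem_add, Multiset.mem_replicate] at hu
  rcases hu with ((⟨-, rfl⟩ | ⟨-, rfl⟩) | ⟨-, rfl⟩) | ⟨-, rfl⟩ <;> constructor <;> linarith

lemma exists_fourValues {M : Multiset ℝ} {n : ℕ} (hn : M.card = n)
    (hM : ∀ x ∈ M, -1 ≤ x ∧ x ≤ 1) (hnot : curveSum M ∉ interior (A3 n)) :
    ∃ (b k l a : ℕ) (s t : ℝ), -1 < s ∧ s < t ∧ t < 1 ∧ M = fourValues b k l a s t := by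
  have split (N : Multiset ℝ) (x : ℝ) :
      N = .replicate (N.count x) x + N.filter (fun y => ¬ y = x) := by
    rw [← Multiset.filter_eq' N x, Multiset.filter_add_not]
  have hM₁ := split M (-1)
  set M₁ := M.filter (fun y => ¬ y = -1) with hM₁_def
  have hM₂ := split M₁ 1
  set N := M₁.filter (fun y => ¬ y = 1) with hN_def
  have hMN : M = N + (.replicate (M.count (-1)) (-1) + .replicate (M₁.count 1) 1) := by
    conv_lhs => rw [hM₁, hM₂]
    abel
  have hN : ∀ x ∈ N, x ∈ Set.Ioo (-1 : ℝ) 1 := by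
    intro x hx
    simp only [hN_def, hM₁_def, Multiset.mem_filter] at hx
    exact ⟨lt_of_le_of_ne (hM x hx.1.1).1 (Ne.symm hx.1.2), lt_of_le_of_ne (hM x hx.1.1).2 hx.2⟩
  have hrest : ∃ (k l : ℕ) (s t : ℝ), -1 < s ∧ s < t ∧ t < 1 ∧
      N = .replicate k s + .replicate l t := by
    rcases N.empty_or_exists_mem with h | ⟨s, hs⟩
    · exact ⟨0, 0, 0, 1 / 2, by norm_num, by norm_num, by norm_num, by simpa using h⟩
    have hNs := split N s
    set N₁ := N.filter (fun y => ¬ y = s) with hN₁_def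
    rcases N₁.empty_or_exists_mem with h | ⟨t, ht⟩
    · obtain ⟨t, hst, ht⟩ := exists_between (hN s hs).2
      exact ⟨N.count s, 0, s, t, (hN s hs).1, hst, ht, by simpa [h] using hNs⟩
    have hNt := split N₁ t
    set N₂ := N₁.filter (fun y => ¬ y = t) with hN₂_def
    have hts : t ≠ s := (Multiset.mem_filter.1 ht).2
    have htN : t ∈ N := (Multiset.mem_filter.1 ht).1
    have hN₂ : N₂ = 0 := by
      by_contra hne
      obtain ⟨u, hu⟩ := Multiset.exists_mem_of_ne_zero hne
      simp only [hN₂_def, hN₁_def, Multiset.mem_filter] at hu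
      obtain ⟨⟨huN, hus⟩, hut⟩ := hu
      obtain ⟨P, hP⟩ := Multiset.exists_cons_of_mem hs
      obtain ⟨Q, hQ⟩ := Multiset.exists_cons_of_mem
        (((Multiset.mem_cons.1 (hP ▸ htN)).resolve_left hts))
      have huP : u ∈ P := (Multiset.mem_cons.1 (hP ▸ huN)).resolve_left hus
      obtain ⟨R, hR⟩ := Multiset.exists_cons_of_mem
        ((Multiset.mem_cons.1 (hQ ▸ huP)).resolve_left hut)
      rw [hP, hQ, hR] at hMN
      simp only [Multiset.cons_add] at hMN
      rw [hMN] at hnot hn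
      refine hnot (curveSum_mem_interior_of_three (hN s hs) (hN t htN) (hN u huN) hts.symm
        (Ne.symm hut) (Ne.symm hus) (fun v hv => hM v ?_) hn)
      rw [hMN]
      simp only [Multiset.mem_cons]
      tauto
    have hNst : N = .replicate (N.count s) s + .replicate (N₁.count t) t := by
      conv_lhs => rw [hNs, hNt, hN₂, add_zero]
    rcases lt_or_gt_of_ne hts with h | h
    · exact ⟨_, _, t, s, (hN t htN).1, h, (hN s hs).2, by rw [add_comm]; exact hNst⟩
    · exact ⟨_, _, s, t, (hN s hs).1, h, (hN t htN).2, hNst⟩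
  obtain ⟨k, l, s, t, hs, hst, ht, hkl⟩ := hrest
  refine ⟨M.count (-1), k, l, M₁.count 1, s, t, hs, hst, ht, hMN.trans ?_⟩
  rw [hkl, fourValues]
  abel

lemma mem_Bplus_union_Bminus {n : ℕ} (hn2 : 2 ≤ n) {M : Multiset ℝ} (hn : M.card = n)
    (hM : ∀ x ∈ M, -1 ≤ x ∧ x ≤ 1) (hnot : curveSum M ∉ interior (A3 n)) :
    curveSum M ∈ Bplus n ∪ Bminus n := by
  obtain ⟨b, k, l, a, s, t, hs, hst, ht, rfl⟩ := exists_fourValues hn hM hnot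
  have hcard := hn
  rw [card_fourValues] at hcard
  have inner (b' k' l' a' : ℕ) (x y z w : ℝ) (hx : -1 ≤ x) (hxy : x < y) (hyz : y ≤ z)
      (hzw : z < w) (hw : w ≤ 1)
      (h : fourValues b k l a s t = x ::ₘ y ::ₘ z ::ₘ w ::ₘ fourValues b' k' l' a' s t) :
      False := by
    rw [h] at hnot hn
    exact hnot (curveSum_mem_interior_of_inner hx hxy hyz hzw hw
      (fun u hu => mem_Icc_of_mem_fourValues hs hst ht hu) hn)
  have hkl : ¬ (2 ≤ k ∧ 2 ≤ l) := by
    rintro ⟨hk, hl⟩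
    obtain ⟨k, rfl⟩ := Nat.exists_eq_add_of_le' hk
    obtain ⟨l, rfl⟩ := Nat.exists_eq_add_of_le' hl
    have h : fourValues b (k + 2) (l + 2) a s t
        = s ::ₘ s ::ₘ t ::ₘ t ::ₘ fourValues b k l a s t := by
      simp only [fourValues, Multiset.replicate_succ, ← Multiset.singleton_add]
      abel
    rw [h] at hnot hn
    exact hnot (curveSum_mem_interior_of_pairs hs hst ht
      (fun u hu => mem_Icc_of_mem_fourValues hs hst ht hu) hn)
  have hbka : ¬ (1 ≤ b ∧ 2 ≤ k ∧ 1 ≤ a) := by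
    rintro ⟨hb, hk, ha⟩
    obtain ⟨b, rfl⟩ := Nat.exists_eq_add_of_le' hb
    obtain ⟨k, rfl⟩ := Nat.exists_eq_add_of_le' hk
    obtain ⟨a, rfl⟩ := Nat.exists_eq_add_of_le' ha
    refine inner b k l a (-1) s s 1 le_rfl hs le_rfl (hst.trans ht) le_rfl ?_
    simp only [fourValues, Multiset.replicate_succ, ← Multiset.singleton_add]
    abel
  have hbla : ¬ (1 ≤ b ∧ 2 ≤ l ∧ 1 ≤ a) := by
    rintro ⟨hb, hl, ha⟩
    obtain ⟨b, rfl⟩ := Nat.exists_eq_add_of_le' hb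
    obtain ⟨l, rfl⟩ := Nat.exists_eq_add_of_le' hl
    obtain ⟨a, rfl⟩ := Nat.exists_eq_add_of_le' ha
    refine inner b k l a (-1) t t 1 le_rfl (hs.trans hst) le_rfl ht le_rfl ?_
    simp only [fourValues, Multiset.replicate_succ, ← Multiset.singleton_add]
    abel
  have hbkla : ¬ (1 ≤ b ∧ 1 ≤ k ∧ 1 ≤ l ∧ 1 ≤ a) := by
    rintro ⟨hb, hk, hl, ha⟩
    obtain ⟨b, rfl⟩ := Nat.exists_eq_add_of_le' hb
    obtain ⟨k, rfl⟩ := Nat.exists_eq_add_of_le' hk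
    obtain ⟨l, rfl⟩ := Nat.exists_eq_add_of_le' hl
    obtain ⟨a, rfl⟩ := Nat.exists_eq_add_of_le' ha
    refine inner b k l a (-1) s t 1 le_rfl hs hst.le ht le_rfl ?_
    simp only [fourValues, Multiset.replicate_succ, ← Multiset.singleton_add]
    abel
  have hbkl : ¬ (1 ≤ b ∧ 2 ≤ k ∧ 1 ≤ l) := by
    rintro ⟨hb, hk, hl⟩
    obtain ⟨b, rfl⟩ := Nat.exists_eq_add_of_le' hb
    obtain ⟨k, rfl⟩ := Nat.exists_eq_add_of_le' hk
    obtain ⟨l, rfl⟩ := Nat.exists_eq_add_of_le' hl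
    refine inner b k l a (-1) s s t le_rfl hs le_rfl hst ht.le ?_
    simp only [fourValues, Multiset.replicate_succ, ← Multiset.singleton_add]
    abel
  have hkla : ¬ (1 ≤ k ∧ 2 ≤ l ∧ 1 ≤ a) := by
    rintro ⟨hk, hl, ha⟩
    obtain ⟨k, rfl⟩ := Nat.exists_eq_add_of_le' hk
    obtain ⟨l, rfl⟩ := Nat.exists_eq_add_of_le' hl
    obtain ⟨a, rfl⟩ := Nat.exists_eq_add_of_le' ha
    refine inner b k l a s t t 1 hs.le hst le_rfl ht le_rfl ?_
    simp only [fourValues, Multiset.replicate_succ, ← Multiset.singleton_add]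
    abel
  have single (v : ℝ) (m : ℕ) (hv : -1 < v) (hv' : v < 1) (hm : b + m + a = n)
      (hba : ¬ (1 ≤ b ∧ 2 ≤ m ∧ 1 ≤ a)) :
      ((m * v + a - b, m * v ^ 2 + a + b, m * v ^ 3 + a - b) : ℝ × ℝ × ℝ) ∈
        Bplus n ∪ Bminus n := by
    rcases Nat.eq_zero_or_pos b with rfl | hb
    · left
      convert mem_Bplus_of_eq (n := n) (k := m) (a := a) hv.le hv'.le (by omega) hn2 using 1
      simp
    rcases m with _ | _ | m
    · left
      convert mem_Bplus_of_eq (n := n) (k := b) (a := a) (s := -1) le_rfl (by norm_num) (by omega)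
        hn2 using 1
      ext <;> simp <;> ring
    · left
      convert mem_Bplus (n := n) (k := b) (a := a) (s := -1) le_rfl hv.le hv'.le hb (by omega)
        using 1
      ext <;> simp <;> ring
    · right
      obtain rfl : a = 0 := by omega
      convert mem_Bminus_of_eq (n := n) (b := b) (l := m + 1 + 1) hv.le hv'.le hb (by omega)
        (by omega) using 1
      ext <;> simp
  rw [curveSum_fourValues]
  rcases Nat.eq_zero_or_pos k with rfl | hk
  · simpa using single t l (hs.trans hst) ht (by omega) hbla
  rcases Nat.eq_zero_or_pos l with rfl | hl
  · simpa using single s k hs (hst.trans ht) (by omega) hbka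
  by_cases h : b = 0 ∧ l = 1
  · obtain ⟨rfl, rfl⟩ := h
    left
    convert mem_Bplus (n := n) (k := k) (a := a) hs.le hst.le ht.le hk (by omega) using 1
    simp
  · obtain ⟨rfl, rfl⟩ : a = 0 ∧ k = 1 := by omega
    right
    convert mem_Bminus (n := n) (l := l) (b := b) hs.le hst.le ht.le hl (by omega) using 1
    simp

/-! ### Extremality of the boundary pieces -/

/-- A cubic with critical points `s ≤ d` is bounded above on `(-∞, d]` by its value at `s`. -/
lemma cubic_le_of_le {s d x : ℝ} (hsd : s ≤ d) (hx : x ≤ d) :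
    2 * x ^ 3 - 3 * (s + d) * x ^ 2 + 6 * s * d * x ≤
      2 * s ^ 3 - 3 * (s + d) * s ^ 2 + 6 * s * d * s := by
  have := mul_nonneg (sq_nonneg (x - s)) (by linarith : 0 ≤ 3 * d - 2 * x - s)
  linarith

/-- A cubic with critical points `s ≤ d` is bounded below on `[s, ∞)` by its value at `d`. -/
lemma le_cubic_of_le {s d x : ℝ} (hsd : s ≤ d) (hx : s ≤ x) :
    2 * d ^ 3 - 3 * (s + d) * d ^ 2 + 6 * s * d * d ≤
      2 * x ^ 3 - 3 * (s + d) * x ^ 2 + 6 * s * d * x := by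
  have := mul_nonneg (sq_nonneg (x - d)) (by linarith : 0 ≤ 2 * x + d - 3 * s)
  linarith

/-- A cubic with critical points `s ≤ d` is increasing on `[d, ∞)`. -/
lemma cubic_le_cubic {s d x y : ℝ} (hsd : s ≤ d) (hx : d ≤ x) (hxy : x ≤ y) :
    2 * x ^ 3 - 3 * (s + d) * x ^ 2 + 6 * s * d * x ≤
      2 * y ^ 3 - 3 * (s + d) * y ^ 2 + 6 * s * d * y := by
  have h1 := mul_nonneg (sub_nonneg.2 hxy) (mul_nonneg (sub_nonneg.2 hx)
    (sub_nonneg.2 (hsd.trans hx)))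
  have h2 := mul_nonneg (sub_nonneg.2 hxy) (mul_nonneg (sub_nonneg.2 hxy)
    (by linarith : 0 ≤ 2 * (y - x) + 6 * x - 3 * s - 3 * d))
  linarith

/-- The sequence consisting of `k` copies of `s`, then `t`, then copies of `1`. -/
def stepFamily (k : ℕ) (s t : ℝ) (i : ℕ) : ℝ := if i < k then s else if i = k then t else 1

lemma sum_stepFamily (k a : ℕ) (s t : ℝ) (g : ℝ → ℝ) :
    ∑ i : Fin (k + 1 + a), g (stepFamily k s t i) = k * g s + g t + a * g 1 := by
  rw [Fin.sum_univ_eq_sum_range (fun i => g (stepFamily k s t i)), Finset.sum_range_add,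
    Finset.sum_range_succ]
  have h1 : ∑ i ∈ Finset.range k, g (stepFamily k s t i) = k * g s := by
    rw [Finset.sum_congr rfl (g := fun _ => g s)]
    · simp
    · intro i hi
      simp [stepFamily, Finset.mem_range.1 hi]
  have h2 (i : ℕ) : stepFamily k s t (k + 1 + i) = 1 := by
    simp only [stepFamily]
    rw [if_neg (by omega), if_neg (by omega)]
  have h3 : stepFamily k s t k = t := by simp [stepFamily]
  simp [h1, h2, h3]

lemma Bplus_subset_A3 (n : ℕ) : Bplus n ⊆ A3 n := by
  intro p hp
  simp only [Bplus, Set.mem_iUnion, Finset.mem_Icc, exists_prop] at hp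
  obtain ⟨k, ⟨hk, hkn⟩, s, t, hs, hst, ht, rfl⟩ := hp
  obtain ⟨a, rfl⟩ : ∃ a, n = k + 1 + a := ⟨n - k - 1, by omega⟩
  refine ⟨fun i => stepFamily k s t i, fun i => ?_, ?_⟩
  · simp only [stepFamily]
    split_ifs <;> constructor <;> linarith
  · have h1 := sum_stepFamily k a s t id
    have h2 := sum_stepFamily k a s t (· ^ 2)
    have h3 := sum_stepFamily k a s t (· ^ 3)
    simp only [id] at h1
    rw [h1, h2, h3]
    simp [show k + 1 + a - k - 1 = a by omega]

lemma cube_sum_le_of_mem_Bplus {n : ℕ} {p q : ℝ × ℝ × ℝ} (hp : p ∈ Bplus n) (hq : q ∈ A3 n)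
    (h1 : q.1 = p.1) (h2 : q.2.1 = p.2.1) : q.2.2 ≤ p.2.2 := by
  simp only [Bplus, Set.mem_iUnion, Finset.mem_Icc, exists_prop] at hp
  obtain ⟨k, ⟨hk, hkn⟩, s, t, hs, hst, ht, rfl⟩ := hp
  obtain ⟨a, rfl⟩ : ∃ a, n = k + 1 + a := ⟨n - k - 1, by omega⟩
  obtain ⟨y, hy, rfl⟩ := hq
  obtain ⟨x, hx, hx1, hmono, hsum⟩ : ∃ x : Fin (k + 1 + a) → ℝ, (∀ i, -1 ≤ x i) ∧ (∀ i, x i ≤ 1) ∧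
      Monotone x ∧ ∀ g : ℝ → ℝ, ∑ i, g (y i) = ∑ i, g (x i) :=
    ⟨y ∘ Tuple.sort y, fun i => (hy _).1, fun i => (hy _).2, Tuple.monotone_sort y,
      fun g => (Equiv.sum_comp (Tuple.sort y) fun i => g (y i)).symm⟩
  have hs1 := hsum id
  simp only [id] at hs1
  simp only [hs1, hsum (· ^ 2), hsum (· ^ 3)] at h1 h2 ⊢
  rw [show k + 1 + a - k - 1 = a by omega] at *
  let m : Fin (k + 1 + a) := ⟨k, by omega⟩
  set d := max s (x m) with hd
  have hsd : s ≤ d := le_max_left _ _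
  have hmd : x m ≤ d := le_max_right _ _
  let g : ℝ → ℝ := fun u => 2 * u ^ 3 - 3 * (s + d) * u ^ 2 + 6 * s * d * u
  have hle : ∑ i, g (x i) ≤ ∑ i : Fin (k + 1 + a), g (stepFamily k s t i) := by
    refine Finset.sum_le_sum fun i _ => ?_
    rcases lt_trichotomy (i : ℕ) k with hi | hi | hi
    · have hxi : x i ≤ x m := hmono (Fin.le_def.2 hi.le)
      simp only [stepFamily, if_pos hi]
      exact cubic_le_of_le hsd (hxi.trans hmd)
    · obtain rfl : i = m := Fin.ext hi
      simp only [stepFamily, m, lt_irrefl, if_true, if_false]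
      change g (x m) ≤ g t
      rcases le_total s (x m) with h | h
      · rw [← max_eq_right h, ← hd]
        exact le_cubic_of_le hsd hst
      · have hds : d = s := max_eq_left h
        exact (cubic_le_of_le hsd hmd).trans (cubic_le_cubic hsd hds.le hst)
    · have hxi : x m ≤ x i := hmono (Fin.le_def.2 hi.le)
      simp only [stepFamily, if_neg hi.not_gt, if_neg hi.ne']
      rcases le_total d (x i) with h | h
      · exact cubic_le_cubic hsd h (hx1 i)
      · rcases le_total s (x m) with h' | h'
        · have : x i = d := le_antisymm h (by rw [hd, max_eq_right h']; exact hxi)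
          exact cubic_le_cubic hsd this.ge (hx1 i)
        · have hds : d = s := max_eq_left h'
          exact (cubic_le_of_le hsd h).trans (cubic_le_cubic hsd hds.le (hst.trans ht))
  rw [sum_stepFamily] at hle
  have hg : ∑ i, g (x i) =
      2 * ∑ i, x i ^ 3 - 3 * (s + d) * ∑ i, x i ^ 2 + 6 * s * d * ∑ i, x i := by
    simp only [g, Finset.sum_add_distrib, Finset.sum_sub_distrib, Finset.mul_sum]
  rw [hg, h1, h2] at hle
  simp only [g] at hle
  linarith

/-! ### The reflection `t ↦ -t` -/

lemma reflect_mem_A3 {n : ℕ} {p : ℝ × ℝ × ℝ} (hp : p ∈ A3 n) :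
    (-p.1, p.2.1, -p.2.2) ∈ A3 n := by
  obtain ⟨t, ht, rfl⟩ := hp
  refine ⟨fun i => -t i, fun i => ⟨by linarith [(ht i).2], by linarith [(ht i).1]⟩, ?_⟩
  simp [Odd.neg_pow (by decide : Odd 3)]

lemma reflect_mem_Bplus {n : ℕ} {p : ℝ × ℝ × ℝ} (hp : p ∈ Bminus n) :
    (-p.1, p.2.1, -p.2.2) ∈ Bplus n := by
  simp only [Bminus, Set.mem_iUnion, Finset.mem_Icc, exists_prop] at hp
  obtain ⟨l, ⟨hl, hln⟩, s, t, hs, hst, ht, rfl⟩ := hp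
  convert mem_Bplus (n := n) (k := l) (a := n - l - 1) (s := -t) (t := -s) (by linarith)
    (by linarith) (by linarith) hl (by omega) using 1
  ext <;> simp <;> ring

lemma not_mem_interior_of_forall_vertical {S : Set (ℝ × ℝ × ℝ)} {p : ℝ × ℝ × ℝ} (σ : ℝ)
    (h : ∀ ε > 0, (p.1, p.2.1, p.2.2 + σ * ε) ∉ S) : p ∉ interior S := by
  intro hp
  have hc : Continuous fun ε : ℝ => (p.1, p.2.1, p.2.2 + σ * ε) := by fun_prop
  have hS : ∀ᶠ ε in 𝓝 (0 : ℝ), (p.1, p.2.1, p.2.2 + σ * ε) ∈ S := by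
    apply hc.continuousAt
    simpa using mem_interior_iff_mem_nhds.1 hp
  obtain ⟨ε, hε, hε0⟩ := ((hS.filter_mono nhdsWithin_le_nhds).and
    (self_mem_nhdsWithin (s := Set.Ioi (0 : ℝ)))).exists
  exact h ε hε0 hε

lemma isClosed_A3 (n : ℕ) : IsClosed (A3 n) := by
  have h : A3 n = (fun t : Fin n → ℝ => (∑ i, t i, ∑ i, t i ^ 2, ∑ i, t i ^ 3)) ''
      Set.univ.pi fun _ => Set.Icc (-1) 1 := by
    ext p
    simp only [A3, Set.mem_ofPred_eq, Set.mem_image, Set.mem_univ_pi, Set.mem_Icc, eq_comm]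
  rw [h]
  exact ((isCompact_univ_pi fun _ => isCompact_Icc).image (by fun_prop)).isClosed

theorem frontier_A3n_eq (n : ℕ) (hn : 3 ≤ n) :
    frontier (A3 n) = Bplus n ∪ Bminus n := by
  rw [(isClosed_A3 n).frontier_eq]
  apply Set.Subset.antisymm
  · rintro p ⟨hp, hnot⟩
    obtain ⟨M, hM, hx, rfl⟩ := mem_A3_iff.1 hp
    exact mem_Bplus_union_Bminus (by omega) hM hx hnot
  · rintro p (hp | hp)
    · refine ⟨Bplus_subset_A3 n hp, not_mem_interior_of_forall_vertical 1 fun ε hε h => ?_⟩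
      have := cube_sum_le_of_mem_Bplus hp h rfl rfl
      simp only at this
      linarith
    · have hp' := reflect_mem_Bplus hp
      refine ⟨by simpa using reflect_mem_A3 (Bplus_subset_A3 n hp'),
        not_mem_interior_of_forall_vertical (-1) fun ε hε h => ?_⟩
      have := cube_sum_le_of_mem_Bplus hp' (reflect_mem_A3 h) rfl rfl
      simp only at this
      linarith
end

section
/- Let n ≥ 3 be an integer. Every point p on the topological boundary of 𝒜_{3,n} can be written as p = (t₁,t₁²,t₁³) + ⋯ + (tₙ,tₙ²,tₙ³) for some tuple (t₁,…,tₙ) ∈ [−1,1]ⁿ. Moreover, for any such representation the set {t₁,…,tₙ} ∖ {−1,1} has at most two elements, and the tuple (t₁,…,tₙ) is unique up to permutation of its entries. -/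
open Set Filter Topology

/-- The map sending a tuple to its first three power sums. -/
def powerSums {n : ℕ} (t : Fin n → ℝ) : ℝ × ℝ × ℝ :=
  (∑ i, t i, ∑ i, (t i) ^ 2, ∑ i, (t i) ^ 3)

theorem sum_comp_update {n : ℕ} (g : ℝ → ℝ) (t : Fin n → ℝ) (i : Fin n) (r : ℝ) :
    ∑ j, g (Function.update t i r j) = ∑ j, g (t j) + (g r - g (t i)) := by
  have h : ∀ j, g (Function.update t i r j)
      = g (t j) + if j = i then g r - g (t i) else 0 := by
    intro j
    by_cases hj : j = i
    · subst hj; simp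
    · simp [hj]
  simp [h, Finset.sum_add_distrib]

theorem isCompact_A3 (n : ℕ) : IsCompact (A3 n) := by
  have h : A3 n = powerSums '' (Set.univ.pi fun _ : Fin n => Icc (-1 : ℝ) 1) := by
    ext p
    simp only [A3, powerSums, mem_ofPred_eq, mem_image, mem_univ_pi, mem_Icc]
    exact exists_congr fun t => and_congr_right fun _ => eq_comm
  rw [h]
  refine (isCompact_univ_pi fun _ => isCompact_Icc).image ?_
  unfold powerSums
  fun_prop

theorem map_nhds_three_powerSums {x y z : ℝ} (hxy : x ≠ y) (hxz : x ≠ z) (hyz : y ≠ z)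
    (c : ℝ × ℝ × ℝ) :
    map (fun v : ℝ × ℝ × ℝ => c + (v.1 + v.2.1 + v.2.2, v.1 ^ 2 + v.2.1 ^ 2 + v.2.2 ^ 2,
        v.1 ^ 3 + v.2.1 ^ 3 + v.2.2 ^ 3)) (𝓝 (x, y, z))
      = 𝓝 (c + (x + y + z, x ^ 2 + y ^ 2 + z ^ 2, x ^ 3 + y ^ 3 + z ^ 3)) := by
  have h1 : HasStrictFDerivAt (fun v : ℝ × ℝ × ℝ => v.1)
      (ContinuousLinearMap.fst ℝ ℝ (ℝ × ℝ)) (x, y, z) := hasStrictFDerivAt_fst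
  have h2 : HasStrictFDerivAt (fun v : ℝ × ℝ × ℝ => v.2.1)
      ((ContinuousLinearMap.fst ℝ ℝ ℝ).comp (ContinuousLinearMap.snd ℝ ℝ (ℝ × ℝ)))
      (x, y, z) := ((ContinuousLinearMap.fst ℝ ℝ ℝ).comp
        (ContinuousLinearMap.snd ℝ ℝ (ℝ × ℝ))).hasStrictFDerivAt
  have h3 : HasStrictFDerivAt (fun v : ℝ × ℝ × ℝ => v.2.2)
      ((ContinuousLinearMap.snd ℝ ℝ ℝ).comp (ContinuousLinearMap.snd ℝ ℝ (ℝ × ℝ)))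
      (x, y, z) := ((ContinuousLinearMap.snd ℝ ℝ ℝ).comp
        (ContinuousLinearMap.snd ℝ ℝ (ℝ × ℝ))).hasStrictFDerivAt
  have hF := (((h1.add h2).add h3).prodMk ((((h1.pow 2).add (h2.pow 2)).add (h3.pow 2)).prodMk
    (((h1.pow 3).add (h2.pow 3)).add (h3.pow 3)))).const_add c
  refine hF.map_nhds_eq_of_surj (LinearMap.range_eq_top.2 ?_)
  rintro ⟨p, q, r⟩
  have a1 := sub_ne_zero.2 hxy
  have a2 := sub_ne_zero.2 hxz
  have a3 := sub_ne_zero.2 hyz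
  refine ⟨((r / 3 - (y + z) * (q / 2) + y * z * p) / ((x - y) * (x - z)),
    -(r / 3 - (x + z) * (q / 2) + x * z * p) / ((x - y) * (y - z)),
    (r / 3 - (x + y) * (q / 2) + x * y * p) / ((x - z) * (y - z))), ?_⟩
  ext
  · simp
    field_simp
    ring
  · simp
    field_simp
    ring
  · simp
    field_simp
    ring

theorem powerSums_mem_interior_of_three {n : ℕ} {t : Fin n → ℝ}
    (ht : ∀ i, -1 ≤ t i ∧ t i ≤ 1) {i j k : Fin n}
    (hi : t i ∈ Ioo (-1 : ℝ) 1) (hj : t j ∈ Ioo (-1 : ℝ) 1) (hk : t k ∈ Ioo (-1 : ℝ) 1)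
    (hij : t i ≠ t j) (hik : t i ≠ t k) (hjk : t j ≠ t k) :
    powerSums t ∈ interior (A3 n) := by
  have nij : i ≠ j := fun h => hij (h ▸ rfl)
  have nik : i ≠ k := fun h => hik (h ▸ rfl)
  have njk : j ≠ k := fun h => hjk (h ▸ rfl)
  have key := map_nhds_three_powerSums hij hik hjk
    (powerSums t - (t i + t j + t k, t i ^ 2 + t j ^ 2 + t k ^ 2, t i ^ 3 + t j ^ 3 + t k ^ 3))
  rw [sub_add_cancel] at key
  rw [mem_interior_iff_mem_nhds, ← key, mem_map]
  have hbox : Ioo (-1 : ℝ) 1 ×ˢ (Ioo (-1 : ℝ) 1 ×ˢ Ioo (-1 : ℝ) 1) ∈ 𝓝 (t i, t j, t k) :=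
    prod_mem_nhds (isOpen_Ioo.mem_nhds hi)
      (prod_mem_nhds (isOpen_Ioo.mem_nhds hj) (isOpen_Ioo.mem_nhds hk))
  filter_upwards [hbox]
  rintro ⟨u, v, w⟩ ⟨hu, hv, hw⟩
  have hsum : ∀ g : ℝ → ℝ, ∑ l, g (Function.update (Function.update (Function.update t i u) j v)
      k w l) = ∑ l, g (t l) + (g u - g (t i)) + (g v - g (t j)) + (g w - g (t k)) := by
    intro g
    simp only [sum_comp_update, Function.update_of_ne nij.symm, Function.update_of_ne nik.symm,
      Function.update_of_ne njk.symm]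
  refine ⟨Function.update (Function.update (Function.update t i u) j v) k w, fun l => ?_, ?_⟩
  · simp only [Function.update_apply]
    split_ifs
    exacts [⟨hw.1.le, hw.2.le⟩, ⟨hv.1.le, hv.2.le⟩, ⟨hu.1.le, hu.2.le⟩, ht l]
  · rw [hsum (fun s => s ^ 2), hsum (fun s => s ^ 3), hsum (fun s => s)]
    ext <;> simp [powerSums] <;> ring

/-- A monic quartic with four distinct roots has the elementary symmetric functions of the roots
as its coefficients. -/
theorem quartic_coeff_eq {α β γ δ r₁ r₂ r₃ r₄ : ℝ} (h₁₂ : r₁ < r₂) (h₂₃ : r₂ < r₃) (h₃₄ : r₃ < r₄)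
    (h₁ : r₁ ^ 4 + α * r₁ ^ 3 + β * r₁ ^ 2 + γ * r₁ + δ = 0)
    (h₂ : r₂ ^ 4 + α * r₂ ^ 3 + β * r₂ ^ 2 + γ * r₂ + δ = 0)
    (h₃ : r₃ ^ 4 + α * r₃ ^ 3 + β * r₃ ^ 2 + γ * r₃ + δ = 0)
    (h₄ : r₄ ^ 4 + α * r₄ ^ 3 + β * r₄ ^ 2 + γ * r₄ + δ = 0) :
    α = -(r₁ + r₂ + r₃ + r₄) ∧
    β = r₁ * r₂ + r₁ * r₃ + r₁ * r₄ + r₂ * r₃ + r₂ * r₄ + r₃ * r₄ ∧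
    γ = -(r₁ * r₂ * r₃ + r₁ * r₂ * r₄ + r₁ * r₃ * r₄ + r₂ * r₃ * r₄) := by
  have d12 : ∀ s, r₁ < s → s ^ 4 + α * s ^ 3 + β * s ^ 2 + γ * s + δ = 0 →
      r₁ ^ 3 + r₁ ^ 2 * s + r₁ * s ^ 2 + s ^ 3 + α * (r₁ ^ 2 + r₁ * s + s ^ 2)
        + β * (r₁ + s) + γ = 0 := by
    intro s hs h
    refine mul_left_cancel₀ (sub_ne_zero.2 hs.ne') ?_
    linear_combination h - h₁
  have e2 := d12 r₂ h₁₂ h₂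
  have e3 := d12 r₃ (h₁₂.trans h₂₃) h₃
  have e4 := d12 r₄ ((h₁₂.trans h₂₃).trans h₃₄) h₄
  have f3 : r₁ ^ 2 + r₂ ^ 2 + r₃ ^ 2 + r₁ * r₂ + r₁ * r₃ + r₂ * r₃ + α * (r₁ + r₂ + r₃) + β = 0 := by
    refine mul_left_cancel₀ (sub_ne_zero.2 h₂₃.ne') ?_
    linear_combination e3 - e2
  have f4 : r₁ ^ 2 + r₂ ^ 2 + r₄ ^ 2 + r₁ * r₂ + r₁ * r₄ + r₂ * r₄ + α * (r₁ + r₂ + r₄) + β = 0 := by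
    refine mul_left_cancel₀ (sub_ne_zero.2 (h₂₃.trans h₃₄).ne') ?_
    linear_combination e4 - e2
  have hα : α = -(r₁ + r₂ + r₃ + r₄) := by
    refine mul_left_cancel₀ (sub_ne_zero.2 h₃₄.ne') ?_
    linear_combination f4 - f3
  have hβ : β = r₁ * r₂ + r₁ * r₃ + r₁ * r₄ + r₂ * r₃ + r₂ * r₄ + r₃ * r₄ := by
    subst hα; linear_combination f3
  refine ⟨hα, hβ, ?_⟩
  subst hα hβ
  linear_combination e2

/-- Raising the constant term of the quartic with roots `a < b ≤ c < d` splits its roots into four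
distinct ones in the open interval `(a, d)`, with the same first three power sums. -/
theorem exists_quadruple_same_powerSums {a b c d : ℝ} (hab : a < b) (hbc : b ≤ c) (hcd : c < d) :
    ∃ r₁ r₂ r₃ r₄ : ℝ, a < r₁ ∧ r₁ < r₂ ∧ r₂ < r₃ ∧ r₃ < r₄ ∧ r₄ < d ∧
      r₁ + r₂ + r₃ + r₄ = a + b + c + d ∧
      r₁ ^ 2 + r₂ ^ 2 + r₃ ^ 2 + r₄ ^ 2 = a ^ 2 + b ^ 2 + c ^ 2 + d ^ 2 ∧
      r₁ ^ 3 + r₂ ^ 3 + r₃ ^ 3 + r₄ ^ 3 = a ^ 3 + b ^ 3 + c ^ 3 + d ^ 3 := by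
  obtain ⟨m, ham, hmb⟩ := exists_between hab
  obtain ⟨m', hcm, hmd⟩ := exists_between hcd
  set P : ℝ → ℝ := fun u => (u - a) * (u - b) * (u - c) * (u - d) with hP
  have hm : P m < 0 := by
    have : 0 < (m - a) * (b - m) * ((c - m) * (d - m)) :=
      mul_pos (mul_pos (by linarith) (by linarith)) (mul_pos (by linarith) (by linarith))
    simp only [hP]; nlinarith
  have hm' : P m' < 0 := by
    have : 0 < (m' - a) * (m' - b) * ((m' - c) * (d - m')) :=
      mul_pos (mul_pos (by linarith) (by linarith)) (mul_pos (by linarith) (by linarith))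
    simp only [hP]; nlinarith
  obtain ⟨ε, hε, hε0⟩ := exists_between (max_lt hm hm')
  have hmε := (le_max_left _ _).trans_lt hε
  have hmε' := (le_max_right _ _).trans_lt hε
  have hcont : ∀ s, ContinuousOn P s := fun s => by
    simp only [hP]; fun_prop
  have hPa : P a = 0 := by simp [hP]
  have hPb : P b = 0 := by simp [hP]
  have hPc : P c = 0 := by simp [hP]
  have hPd : P d = 0 := by simp [hP]
  obtain ⟨r₁, ⟨l₁, u₁⟩, e₁⟩ := intermediate_value_Ioo' ham.le (hcont _) ⟨hmε, hPa ▸ hε0⟩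
  obtain ⟨r₂, ⟨l₂, u₂⟩, e₂⟩ := intermediate_value_Ioo hmb.le (hcont _) ⟨hmε, hPb ▸ hε0⟩
  obtain ⟨r₃, ⟨l₃, u₃⟩, e₃⟩ := intermediate_value_Ioo' hcm.le (hcont _) ⟨hmε', hPc ▸ hε0⟩
  obtain ⟨r₄, ⟨l₄, u₄⟩, e₄⟩ := intermediate_value_Ioo hmd.le (hcont _) ⟨hmε', hPd ▸ hε0⟩
  have h₁₂ : r₁ < r₂ := u₁.trans l₂
  have h₂₃ : r₂ < r₃ := (u₂.trans_le hbc).trans l₃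
  have h₃₄ : r₃ < r₄ := u₃.trans l₄
  have hroot : ∀ r, P r = ε → r ^ 4 + -(a + b + c + d) * r ^ 3
      + (a * b + a * c + a * d + b * c + b * d + c * d) * r ^ 2
      + -(a * b * c + a * b * d + a * c * d + b * c * d) * r + (a * b * c * d - ε) = 0 := by
    intro r hr
    simp only [hP] at hr
    linear_combination hr
  obtain ⟨hα, hβ, hγ⟩ := quartic_coeff_eq h₁₂ h₂₃ h₃₄ (hroot r₁ e₁) (hroot r₂ e₂) (hroot r₃ e₃)
    (hroot r₄ e₄)
  refine ⟨r₁, r₂, r₃, r₄, l₁, h₁₂, h₂₃, h₃₄, u₄, ?_, ?_, ?_⟩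
  · linear_combination hα
  · linear_combination (r₁ + r₂ + r₃ + r₄ + (a + b + c + d)) * hα + 2 * hβ
  · linear_combination ((r₁ + r₂ + r₃ + r₄) ^ 2 + (r₁ + r₂ + r₃ + r₄) * (a + b + c + d)
      + (a + b + c + d) ^ 2 - 3 * (r₁ * r₂ + r₁ * r₃ + r₁ * r₄ + r₂ * r₃ + r₂ * r₄ + r₃ * r₄)) * hα
      + 3 * (a + b + c + d) * hβ + 3 * hγ

theorem powerSums_mem_interior_of_four {n : ℕ} {t : Fin n → ℝ}
    (ht : ∀ i, -1 ≤ t i ∧ t i ≤ 1) {i j k l : Fin n} (hjk : j ≠ k)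
    (hij : t i < t j) (hjk_le : t j ≤ t k) (hkl : t k < t l) :
    powerSums t ∈ interior (A3 n) := by
  have nij : i ≠ j := fun h => hij.ne (h ▸ rfl)
  have nik : i ≠ k := fun h => (hij.trans_le hjk_le).ne (h ▸ rfl)
  have nil : i ≠ l := fun h => ((hij.trans_le hjk_le).trans hkl).ne (h ▸ rfl)
  have njl : j ≠ l := fun h => (hjk_le.trans_lt hkl).ne (h ▸ rfl)
  have nkl : k ≠ l := fun h => hkl.ne (h ▸ rfl)
  obtain ⟨r₁, r₂, r₃, r₄, l₁, h₁₂, h₂₃, h₃₄, u₄, s₁, s₂, s₃⟩ :=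
    exists_quadruple_same_powerSums hij hjk_le hkl
  have hi := (ht i).1
  have hl := (ht l).2
  set s := Function.update (Function.update (Function.update (Function.update t i r₁) j r₂) k r₃)
    l r₄ with hs
  have hsum : ∀ g : ℝ → ℝ, ∑ m, g (s m) = ∑ m, g (t m) + (g r₁ - g (t i)) + (g r₂ - g (t j))
      + (g r₃ - g (t k)) + (g r₄ - g (t l)) := by
    intro g
    simp only [hs, sum_comp_update, Function.update_of_ne nij.symm, Function.update_of_ne nik.symm,
      Function.update_of_ne hjk.symm, Function.update_of_ne nil.symm, Function.update_of_ne njl.symm,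
      Function.update_of_ne nkl.symm]
  have hpow : powerSums s = powerSums t := by
    have q₁ := hsum (fun u => u)
    have q₂ := hsum (fun u => u ^ 2)
    have q₃ := hsum (fun u => u ^ 3)
    simp only [powerSums, Prod.mk.injEq]
    exact ⟨by linarith, by linarith, by linarith⟩
  have hsi : s i = r₁ := by simp [hs, nij, nik, nil]
  have hsj : s j = r₂ := by simp [hs, hjk, njl]
  have hsk : s k = r₃ := by simp [hs, nkl]
  rw [← hpow]
  refine powerSums_mem_interior_of_three (i := i) (j := j) (k := k) (fun m => ?_) ?_ ?_ ?_ ?_ ?_ ?_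
  · simp only [hs, Function.update_apply]
    split_ifs
    exacts [⟨by linarith, by linarith⟩, ⟨by linarith, by linarith⟩, ⟨by linarith, by linarith⟩,
      ⟨by linarith, by linarith⟩, ht m]
  · rw [hsi]; exact ⟨by linarith, by linarith⟩
  · rw [hsj]; exact ⟨by linarith, by linarith⟩
  · rw [hsk]; exact ⟨by linarith, by linarith⟩
  · rw [hsi, hsj]; exact h₁₂.ne
  · rw [hsi, hsk]; exact (h₁₂.trans h₂₃).ne
  · rw [hsj, hsk]; exact h₂₃.ne

/-- An antiderivative of `(u - α) * (u - β)` detects equality of `x` and `y` when that quadratic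
has constant sign between them. -/
theorem cubic_le_of_separated {α β x y : ℝ} (hαβ : α ≤ β)
    (h : (x ≤ y ∧ y ≤ α) ∨ (α ≤ y ∧ y ≤ x ∧ x ≤ β) ∨ (β ≤ x ∧ x ≤ y)) :
    x ^ 3 / 3 - (α + β) / 2 * x ^ 2 + α * β * x ≤ y ^ 3 / 3 - (α + β) / 2 * y ^ 2 + α * β * y ∧
    (x ^ 3 / 3 - (α + β) / 2 * x ^ 2 + α * β * x = y ^ 3 / 3 - (α + β) / 2 * y ^ 2 + α * β * y →
      x = y) := by
  have hfac : (y ^ 3 / 3 - (α + β) / 2 * y ^ 2 + α * β * y)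
      - (x ^ 3 / 3 - (α + β) / 2 * x ^ 2 + α * β * x)
      = (y - x) * ((2 * (x - α) * (x - β) + (x - α) * (y - β) + (y - α) * (x - β)
        + 2 * (y - α) * (y - β)) / 6) := by ring
  rcases eq_or_ne x y with rfl | hne
  · simp
  suffices 0 < (y - x) * ((2 * (x - α) * (x - β) + (x - α) * (y - β) + (y - α) * (x - β)
        + 2 * (y - α) * (y - β)) / 6) from
    ⟨by linarith, fun h => absurd h (by intro h; linarith)⟩
  rcases h with ⟨h₁, h₂⟩ | ⟨h₁, h₂, h₃⟩ | ⟨h₁, h₂⟩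
  · have hlt := lt_of_le_of_ne h₁ hne
    refine mul_pos (by linarith) ?_
    have p₁ : 0 < (α - x) * (β - x) := mul_pos (by linarith) (by linarith)
    have p₂ : 0 ≤ (α - x) * (β - y) := mul_nonneg (by linarith) (by linarith)
    have p₃ : 0 ≤ (α - y) * (β - x) := mul_nonneg (by linarith) (by linarith)
    have p₄ : 0 ≤ (α - y) * (β - y) := mul_nonneg (by linarith) (by linarith)
    linarith
  · have hlt := lt_of_le_of_ne h₂ hne.symm
    refine mul_pos_of_neg_of_neg (by linarith) ?_
    have p₁ : 0 ≤ (x - α) * (β - x) := mul_nonneg (by linarith) (by linarith)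
    have p₂ : 0 < (x - α) * (β - y) := mul_pos (by linarith) (by linarith)
    have p₃ : 0 ≤ (y - α) * (β - x) := mul_nonneg (by linarith) (by linarith)
    have p₄ : 0 ≤ (y - α) * (β - y) := mul_nonneg (by linarith) (by linarith)
    linarith
  · have hlt := lt_of_le_of_ne h₂ hne
    refine mul_pos (by linarith) ?_
    have p₁ : 0 ≤ (x - α) * (x - β) := mul_nonneg (by linarith) (by linarith)
    have p₂ : 0 ≤ (x - α) * (y - β) := mul_nonneg (by linarith) (by linarith)
    have p₃ : 0 ≤ (y - α) * (x - β) := mul_nonneg (by linarith) (by linarith)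
    have p₄ : 0 < (y - α) * (y - β) := mul_pos (by linarith) (by linarith)
    linarith

theorem eq_of_separated {n : ℕ} {s s' : Fin n → ℝ} (hp : powerSums s = powerSums s')
    {α β : ℝ} (hαβ : α ≤ β)
    (h : ∀ i, (s i ≤ s' i ∧ s' i ≤ α) ∨ (α ≤ s' i ∧ s' i ≤ s i ∧ s i ≤ β) ∨
      (β ≤ s i ∧ s i ≤ s' i)) : s = s' := by
  simp only [powerSums, Prod.mk.injEq] at hp
  obtain ⟨h₁, h₂, h₃⟩ := hp
  have hsum : ∑ i, ((s i) ^ 3 / 3 - (α + β) / 2 * (s i) ^ 2 + α * β * s i)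
      = ∑ i, ((s' i) ^ 3 / 3 - (α + β) / 2 * (s' i) ^ 2 + α * β * s' i) := by
    simp only [Finset.sum_add_distrib, Finset.sum_sub_distrib, ← Finset.mul_sum,
      ← Finset.sum_div, h₁, h₂, h₃]
  funext i
  exact (cubic_le_of_separated hαβ (h i)).2
    ((Finset.sum_eq_sum_iff_of_le fun i _ => (cubic_le_of_separated hαβ (h i)).1).1 hsum i
      (Finset.mem_univ i))

theorem exists_minimal_of_exists {n : ℕ} {p : Fin n → Prop} (h : ∃ i, p i) :
    ∃ i, p i ∧ ∀ j, j < i → ¬ p j := by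
  obtain ⟨i, hi⟩ := exists_minimal_of_wellFoundedLT p h
  exact ⟨i, hi.1, fun j hj => hi.not_prop_of_lt hj⟩

/-- Two monotone tuples with the same first three power sums whose first difference has a given
sign interlace at four indices. -/
theorem exists_interlacing {n : ℕ} {s s' : Fin n → ℝ} (hs : Monotone s) (hs' : Monotone s')
    (hp : powerSums s = powerSums s') {i : Fin n} (hi : s i < s' i) (hlt : ∀ j, j < i → s j = s' j) :
    ∃ j k l, i < j ∧ j < k ∧ k < l ∧ s' j < s j ∧ s k < s' k ∧ s' l < s l := by
  obtain ⟨M, hM⟩ : ∃ M, ∀ j, s j ≤ M ∧ s' j ≤ M := by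
    obtain ⟨M, hM⟩ := (Set.finite_range s).bddAbove
    obtain ⟨M', hM'⟩ := (Set.finite_range s').bddAbove
    exact ⟨max M M', fun j => ⟨(hM ⟨j, rfl⟩).trans (le_max_left _ _),
      (hM' ⟨j, rfl⟩).trans (le_max_right _ _)⟩⟩
  by_contra! hno
  refine hi.ne (congrFun ?_ i)
  by_cases hj : ∃ j, s' j < s j
  swap
  · push Not at hj
    exact eq_of_separated hp le_rfl fun m => Or.inl ⟨hj m, (hM m).2⟩
  obtain ⟨j, hj, hj_min⟩ := exists_minimal_of_exists hj
  have hij : i < j := by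
    by_contra! h
    rcases h.lt_or_eq with h | h
    · exact hj.ne' (hlt j h)
    · exact hi.not_gt (h ▸ hj)
  have hbefore : ∀ m, m < j → s m ≤ s' m ∧ s' m ≤ s' j := fun m hm =>
    ⟨not_lt.1 (hj_min m hm), hs' hm.le⟩
  by_cases hk : ∃ k, j < k ∧ s k < s' k
  swap
  · push Not at hk
    refine eq_of_separated hp ((hs' le_rfl).trans (hM j).2) fun m => ?_
    rcases lt_or_ge m j with hm | hm
    · exact Or.inl (hbefore m hm)
    · refine Or.inr (Or.inl ⟨hs' hm, ?_, (hM m).1⟩)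
      rcases hm.eq_or_lt with rfl | hm
      exacts [hj.le, hk m hm]
  obtain ⟨k, ⟨hjk, hk⟩, hk_min⟩ := exists_minimal_of_exists hk
  refine eq_of_separated hp (hj.le.trans (hs hjk.le)) fun m => ?_
  rcases lt_or_ge m j with hm | hm
  · exact Or.inl (hbefore m hm)
  rcases lt_or_ge m k with hmk | hmk
  · refine Or.inr (Or.inl ⟨hs' hm, ?_, hs hmk.le⟩)
    rcases hm.eq_or_lt with rfl | hm
    exacts [hj.le, not_lt.1 fun h => hk_min m hmk ⟨hm, h⟩]
  · refine Or.inr (Or.inr ⟨hs hmk, ?_⟩)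
    rcases hmk.eq_or_lt with rfl | hmk
    exacts [hk.le, hno j k m hij hjk hmk hj hk]

theorem powerSums_mem_interior_of_first_lt {n : ℕ} {s s' : Fin n → ℝ}
    (hbox : ∀ i, -1 ≤ s i ∧ s i ≤ 1) (hs : Monotone s) (hs' : Monotone s')
    (hp : powerSums s = powerSums s') {i : Fin n} (hi : s i < s' i) (hlt : ∀ j, j < i → s j = s' j) :
    powerSums s ∈ interior (A3 n) := by
  obtain ⟨j, k, l, hij, hjk, hkl, hj, hk, hl⟩ := exists_interlacing hs hs' hp hi hlt
  exact powerSums_mem_interior_of_four hbox hjk.ne ((hi.trans_le (hs' hij.le)).trans hj)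
    (hs hjk.le) ((hk.trans_le (hs' hkl.le)).trans hl)

theorem powerSums_mem_interior_of_ne {n : ℕ} {s s' : Fin n → ℝ}
    (hbox : ∀ i, -1 ≤ s i ∧ s i ≤ 1) (hbox' : ∀ i, -1 ≤ s' i ∧ s' i ≤ 1)
    (hs : Monotone s) (hs' : Monotone s') (hp : powerSums s = powerSums s') (hne : s ≠ s') :
    powerSums s ∈ interior (A3 n) := by
  obtain ⟨i, hi, hmin⟩ := exists_minimal_of_exists (Function.ne_iff.1 hne)
  rcases lt_or_gt_of_ne hi with h | h
  · exact powerSums_mem_interior_of_first_lt hbox hs hs' hp h fun j hj => not_not.1 (hmin j hj)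
  · rw [hp]
    exact powerSums_mem_interior_of_first_lt hbox' hs' hs hp.symm h
      fun j hj => (not_not.1 (hmin j hj)).symm

theorem powerSums_comp_perm {n : ℕ} (t : Fin n → ℝ) (σ : Equiv.Perm (Fin n)) :
    powerSums (t ∘ σ) = powerSums t := by
  simp only [powerSums, Function.comp_apply, Equiv.sum_comp σ t,
    Equiv.sum_comp σ fun i => t i ^ 2, Equiv.sum_comp σ fun i => t i ^ 3]

theorem boundary_representation (n : ℕ) (hn : 3 ≤ n) (p : ℝ × ℝ × ℝ)
    (hp : p ∈ frontier (A3 n)) :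
    (∃ t : Fin n → ℝ, (∀ i, -1 ≤ t i ∧ t i ≤ 1) ∧
        p = (∑ i, t i, ∑ i, (t i) ^ 2, ∑ i, (t i) ^ 3)) ∧
    (∀ t : Fin n → ℝ, (∀ i, -1 ≤ t i ∧ t i ≤ 1) →
        p = (∑ i, t i, ∑ i, (t i) ^ 2, ∑ i, (t i) ^ 3) →
        (Set.range t \ {-1, 1}).ncard ≤ 2) ∧
    (∀ t t' : Fin n → ℝ, (∀ i, -1 ≤ t i ∧ t i ≤ 1) → (∀ i, -1 ≤ t' i ∧ t' i ≤ 1) →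
        p = (∑ i, t i, ∑ i, (t i) ^ 2, ∑ i, (t i) ^ 3) →
        p = (∑ i, t' i, ∑ i, (t' i) ^ 2, ∑ i, (t' i) ^ 3) →
        ∃ σ : Equiv.Perm (Fin n), t' = t ∘ σ) := by
  have hclosed : IsClosed (A3 n) := (isCompact_A3 n).isClosed
  have hint : p ∉ interior (A3 n) := hp.2
  refine ⟨(show p ∈ A3 n from hclosed.frontier_subset hp), fun t ht hpt => ?_, fun t t' ht ht' hpt hpt' => ?_⟩
  · by_contra! hcard
    have hfin : (Set.range t \ {-1, 1}).Finite := (Set.finite_range t).sdiff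
    obtain ⟨a, b, c, ⟨⟨i, rfl⟩, ha⟩, ⟨⟨j, rfl⟩, hb⟩, ⟨⟨k, rfl⟩, hc⟩, hab, hac, hbc⟩ :=
      (Set.two_lt_ncard_iff hfin).1 hcard
    have hmem : ∀ m, t m ∉ ({-1, 1} : Set ℝ) → t m ∈ Ioo (-1 : ℝ) 1 := by
      intro m hm
      simp only [mem_insert_iff, mem_singleton_iff, not_or] at hm
      exact ⟨lt_of_le_of_ne (ht m).1 (Ne.symm hm.1), lt_of_le_of_ne (ht m).2 hm.2⟩
    refine hint ?_
    rw [hpt]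
    exact powerSums_mem_interior_of_three ht (hmem i ha) (hmem j hb) (hmem k hc) hab hac hbc
  · have heq : t ∘ Tuple.sort t = t' ∘ Tuple.sort t' := by
      by_contra hne
      refine hint ?_
      have h := powerSums_mem_interior_of_ne (s := t ∘ Tuple.sort t) (s' := t' ∘ Tuple.sort t')
        (fun i => ht (Tuple.sort t i))
        (fun i => ht' (Tuple.sort t' i)) (Tuple.monotone_sort t) (Tuple.monotone_sort t')
        (by rw [powerSums_comp_perm, powerSums_comp_perm]; exact hpt.symm.trans hpt') hne
      rw [powerSums_comp_perm] at h
      rw [hpt]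
      exact h
    refine ⟨(Tuple.sort t').symm.trans (Tuple.sort t), funext fun i => ?_⟩
    simpa using (congrFun heq ((Tuple.sort t').symm i)).symm
end

section
/- Let s, t be real numbers with −1 < s < t < 1. Then the point (s,s²,s³) + (t,t²,t³) + (1,1,1) + (−1,1,−1) does not lie on the topological boundary of 𝒜_{3,4}. -/
/-- The monic quartic whose roots have first three power sums `q` and whose constant term is `k`,
evaluated at `x`; its coefficients are given by Newton's identities. -/
noncomputable def newtonQuartic (k : ℝ) (q : ℝ × ℝ × ℝ) (x : ℝ) : ℝ :=
  x ^ 4 - q.1 * x ^ 3 + (q.1 ^ 2 - q.2.1) / 2 * x ^ 2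
    - (q.1 ^ 3 - 3 * q.1 * q.2.1 + 2 * q.2.2) / 6 * x + k

lemma continuous_newtonQuartic (k x : ℝ) : Continuous fun q => newtonQuartic k q x := by
  unfold newtonQuartic
  fun_prop

lemma continuous_newtonQuartic_right (k : ℝ) (q : ℝ × ℝ × ℝ) :
    Continuous (newtonQuartic k q) := by
  unfold newtonQuartic
  fun_prop

/-- Vieta's formulas for a monic quartic with four distinct real roots. -/
lemma vieta_quartic {a b c d e₁ e₂ e₃ k : ℝ} (hab : a ≠ b) (hac : a ≠ c) (had : a ≠ d)
    (hbc : b ≠ c) (hbd : b ≠ d) (hcd : c ≠ d)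
    (ha : a ^ 4 - e₁ * a ^ 3 + e₂ * a ^ 2 - e₃ * a + k = 0)
    (hb : b ^ 4 - e₁ * b ^ 3 + e₂ * b ^ 2 - e₃ * b + k = 0)
    (hc : c ^ 4 - e₁ * c ^ 3 + e₂ * c ^ 2 - e₃ * c + k = 0)
    (hd : d ^ 4 - e₁ * d ^ 3 + e₂ * d ^ 2 - e₃ * d + k = 0) :
    e₁ = a + b + c + d ∧ e₂ = a * b + a * c + a * d + b * c + b * d + c * d ∧
      e₃ = a * b * c + a * b * d + a * c * d + b * c * d := by
  have first {x : ℝ} (hax : a ≠ x) (hx : x ^ 4 - e₁ * x ^ 3 + e₂ * x ^ 2 - e₃ * x + k = 0) :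
      a ^ 3 + a ^ 2 * x + a * x ^ 2 + x ^ 3 - e₁ * (a ^ 2 + a * x + x ^ 2) + e₂ * (a + x)
        - e₃ = 0 := by
    apply mul_left_cancel₀ (sub_ne_zero.2 hax)
    linear_combination ha - hx
  have hb' := first hab hb
  have second {x : ℝ} (hax : a ≠ x) (hbx : b ≠ x)
      (hx : x ^ 4 - e₁ * x ^ 3 + e₂ * x ^ 2 - e₃ * x + k = 0) :
      a ^ 2 + b ^ 2 + x ^ 2 + a * b + a * x + b * x - e₁ * (a + b + x) + e₂ = 0 := by
    apply mul_left_cancel₀ (sub_ne_zero.2 hbx)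
    linear_combination hb' - first hax hx
  have hc' := second hac hbc hc
  have h₁ : e₁ = a + b + c + d := by
    apply mul_left_cancel₀ (sub_ne_zero.2 hcd)
    linear_combination second had hbd hd - hc'
  subst h₁
  have h₂ : e₂ = a * b + a * c + a * d + b * c + b * d + c * d := by linear_combination hc'
  subst h₂
  exact ⟨rfl, rfl, by linear_combination -hb'⟩

lemma mem_A3_of_newtonQuartic_roots {a b c d k : ℝ} {q : ℝ × ℝ × ℝ} (ha₁ : -1 < a) (hab : a < b)
    (hbc : b < c) (hcd : c < d) (hd₁ : d < 1) (ha : newtonQuartic k q a = 0)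
    (hb : newtonQuartic k q b = 0) (hc : newtonQuartic k q c = 0)
    (hd : newtonQuartic k q d = 0) : q ∈ A3 4 := by
  obtain ⟨x, y, z⟩ := q
  obtain ⟨h₁, h₂, h₃⟩ := vieta_quartic hab.ne (hab.trans hbc).ne (hab.trans (hbc.trans hcd)).ne
    hbc.ne (hbc.trans hcd).ne hcd.ne ha hb hc hd
  dsimp only at h₁ h₂ h₃
  refine ⟨![a, b, c, d], ?_, ?_⟩
  · intro i
    fin_cases i <;> constructor <;> simp <;> linarith
  · subst h₁
    have hy : y = a ^ 2 + b ^ 2 + c ^ 2 + d ^ 2 := by linear_combination -2 * h₂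
    subst hy
    have hz : z = a ^ 3 + b ^ 3 + c ^ 3 + d ^ 3 := by linear_combination 3 * h₃
    subst hz
    simp [Fin.sum_univ_four]

/-- A quartic with alternating signs at five points of `[-1, 1]` has four roots in `(-1, 1)`. -/
lemma mem_A3_of_newtonQuartic_signs {k u v w : ℝ} {q : ℝ × ℝ × ℝ} (hu : -1 < u) (huv : u < v)
    (hvw : v < w) (hw : w < 1) (h₁ : 0 < newtonQuartic k q (-1)) (h₂ : newtonQuartic k q u < 0)
    (h₃ : 0 < newtonQuartic k q v) (h₄ : newtonQuartic k q w < 0)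
    (h₅ : 0 < newtonQuartic k q 1) : q ∈ A3 4 := by
  have hcont := continuous_newtonQuartic_right k q
  obtain ⟨a, ⟨ha, ha'⟩, ha₀⟩ := intermediate_value_Ioo' hu.le hcont.continuousOn ⟨h₂, h₁⟩
  obtain ⟨b, ⟨hb, hb'⟩, hb₀⟩ := intermediate_value_Ioo huv.le hcont.continuousOn ⟨h₂, h₃⟩
  obtain ⟨c, ⟨hc, hc'⟩, hc₀⟩ := intermediate_value_Ioo' hvw.le hcont.continuousOn ⟨h₄, h₃⟩
  obtain ⟨d, ⟨hd, hd'⟩, hd₀⟩ := intermediate_value_Ioo hw.le hcont.continuousOn ⟨h₄, h₅⟩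
  exact mem_A3_of_newtonQuartic_roots ha (ha'.trans hb) (hb'.trans hc) (hc'.trans hd) hd'
    ha₀ hb₀ hc₀ hd₀

lemma newtonQuartic_eq (s t ε x : ℝ) :
    newtonQuartic (ε - s * t)
      (s + t + 1 + -1, s ^ 2 + t ^ 2 + 1 + 1, s ^ 3 + t ^ 3 + 1 + -1) x =
      ε - (x - s) * (x - t) * ((1 - x) * (1 + x)) := by
  unfold newtonQuartic
  ring

theorem one_one_one_one_not_boundary (s t : ℝ) (hs : -1 < s) (hst : s < t) (ht : t < 1) :
    (s + t + 1 + -1, s ^ 2 + t ^ 2 + 1 + 1, s ^ 3 + t ^ 3 + 1 + -1) ∉ frontier (A3 4) := by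
  obtain ⟨u, hu, hus⟩ := exists_between hs
  obtain ⟨v, hsv, hvt⟩ := exists_between hst
  obtain ⟨w, htw, hw⟩ := exists_between ht
  have hpu : 0 < (u - s) * (u - t) * ((1 - u) * (1 + u)) :=
    mul_pos (mul_pos_of_neg_of_neg (by linarith) (by linarith))
      (mul_pos (by linarith) (by linarith))
  have hpv : (v - s) * (v - t) * ((1 - v) * (1 + v)) < 0 :=
    mul_neg_of_neg_of_pos (mul_neg_of_pos_of_neg (by linarith) (by linarith))
      (mul_pos (by linarith) (by linarith))
  have hpw : 0 < (w - s) * (w - t) * ((1 - w) * (1 + w)) :=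
    mul_pos (mul_pos (by linarith) (by linarith)) (mul_pos (by linarith) (by linarith))
  obtain ⟨ε, hε, hεlt⟩ := exists_between (lt_min hpu hpw)
  obtain ⟨hεu, hεw⟩ := lt_min_iff.1 hεlt
  have hpos (x : ℝ) : IsOpen {q | 0 < newtonQuartic (ε - s * t) q x} :=
    isOpen_lt continuous_const (continuous_newtonQuartic _ x)
  have hneg (x : ℝ) : IsOpen {q | newtonQuartic (ε - s * t) q x < 0} :=
    isOpen_lt (continuous_newtonQuartic _ x) continuous_const
  refine fun h => h.2 (mem_interior_iff_mem_nhds.2 ?_)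
  filter_upwards [
    (hpos (-1)).mem_nhds (by rw [Set.mem_ofPred_eq, newtonQuartic_eq]; linarith),
    (hneg u).mem_nhds (by rw [Set.mem_ofPred_eq, newtonQuartic_eq]; linarith),
    (hpos v).mem_nhds (by rw [Set.mem_ofPred_eq, newtonQuartic_eq]; linarith),
    (hneg w).mem_nhds (by rw [Set.mem_ofPred_eq, newtonQuartic_eq]; linarith),
    (hpos 1).mem_nhds (by rw [Set.mem_ofPred_eq, newtonQuartic_eq]; linarith)]
    with q h₁ h₂ h₃ h₄ h₅
  exact mem_A3_of_newtonQuartic_signs hu (hus.trans hsv) (hvt.trans htw) hw h₁ h₂ h₃ h₄ h₅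
end
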